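/- Let d ≥ 3 and let μ be a probability measure on the unit sphere S^{d−1} ⊂ ℝ^d. Suppose μ is invariant under the action of every permutation matrix E_π, π ∈ S_d (exchangeability of the coordinates), and suppose there exist k ≥ 3 and a continuous group homomorphism φ : SO(k) → SO(d) acting irreducibly on ℝ^d such that μ is invariant under φ(g) for every g ∈ SO(k). Then μ is the normalized uniform (rotation-invariant) probability measure on S^{d−1}. -/

import Mathlib

open Matrix MeasureTheory

/-- The special orthogonal group `SO(n)`, realized as the subgroup of the orthogonal group
`O(n)` consisting of the matrices of determinant one. -/
def SO (n : ℕ) : Subgroup (Matrix.orthogonalGroup (Fin n) ℝ) where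
  carrier := {A | Matrix.det (A : Matrix (Fin n) (Fin n) ℝ) = 1}
  mul_mem' := by
    intro a b ha hb
    simp only [Set.mem_setOf_eq, Submonoid.coe_mul, Matrix.det_mul] at *
    rw [ha, hb, mul_one]
  one_mem' := by
    simp [Set.mem_setOf_eq]
  inv_mem' := by
    intro a ha
    simp only [Set.mem_setOf_eq] at *
    have h : ((a⁻¹ * a : Matrix.orthogonalGroup (Fin n) ℝ) : Matrix (Fin n) (Fin n) ℝ)
        = (1 : Matrix (Fin n) (Fin n) ℝ) := by
      rw [inv_mul_cancel]; rfl
    have := congrArg Matrix.det h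
    rw [Submonoid.coe_mul, Matrix.det_mul, ha, mul_one, Matrix.det_one] at this
    exact this

/-- The matrix of an element of `SO(n)`. -/
def SOmat {n : ℕ} (g : SO n) : Matrix (Fin n) (Fin n) ℝ :=
  ((g : Matrix.orthogonalGroup (Fin n) ℝ) : Matrix (Fin n) (Fin n) ℝ)

/-- The normalized uniform (rotation-invariant) probability measure on the unit sphere
`S^{d-1} ⊂ ℝ^d`. -/
noncomputable def uniformSphere (d : ℕ) :
    Measure (Metric.sphere (0 : EuclideanSpace ℝ (Fin d)) 1) :=
  (((volume : Measure (EuclideanSpace ℝ (Fin d))).toSphere Set.univ)⁻¹ •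
    (volume : Measure (EuclideanSpace ℝ (Fin d))).toSphere)

/-- `T_i = e_i ∧ 1`. -/
def TT {d : ℕ} (i : Fin d) : Matrix (Fin d) (Fin d) ℝ :=
  Matrix.of fun a b => (if a = i then 1 else 0) - (if b = i then 1 else 0)

theorem alg_T {d : ℕ} (V : Submodule ℝ (Matrix (Fin d) (Fin d) ℝ))
    (hperm : ∀ (π : Equiv.Perm (Fin d)) X, X ∈ V → X.submatrix π π ∈ V)
    (X : Matrix (Fin d) (Fin d) ℝ) (hX : X ∈ V) (hskew : ∀ a b, X a b = - X b a)
    (i : Fin d) (h1 : ∑ k, X i k ≠ 0) : TT i ∈ V := by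
  classical
  set S : Finset (Equiv.Perm (Fin d)) := Finset.univ.filter (fun σ => σ i = i) with hS
  set Z : Matrix (Fin d) (Fin d) ℝ := ∑ σ ∈ S, X.submatrix σ σ with hZ
  have hZV : Z ∈ V := V.sum_mem fun σ _ => hperm σ X hX
  have hZa : ∀ a b, Z a b = ∑ σ ∈ S, X (σ a) (σ b) := by
    intro a b; rw [hZ, Matrix.sum_apply]; rfl
  have hinv : ∀ (τ : Equiv.Perm (Fin d)), τ i = i → ∀ a b, Z (τ a) (τ b) = Z a b := by
    intro τ hτ a b
    rw [hZa, hZa]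
    refine Finset.sum_bij (fun σ _ => σ * τ) ?_ ?_ ?_ ?_
    · intro σ hσ
      simp only [hS, Finset.mem_filter, Finset.mem_univ, true_and] at hσ ⊢
      simp [hτ, hσ]
    · intro σ _ σ' _ h
      exact mul_right_cancel h
    · intro σ hσ
      simp only [hS, Finset.mem_filter, Finset.mem_univ, true_and] at hσ
      refine ⟨σ * τ⁻¹, ?_, by simp⟩
      simp only [hS, Finset.mem_filter, Finset.mem_univ, true_and]
      have : τ⁻¹ i = i := by rw [Equiv.Perm.inv_eq_iff_eq, hτ]
      rw [Equiv.Perm.mul_apply, this, hσ]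
    · intro σ _; simp
  have hZs : ∀ a b, Z a b = - Z b a := by
    intro a b
    rw [hZa, hZa, ← Finset.sum_neg_distrib]
    exact Finset.sum_congr rfl fun σ _ => hskew _ _
  have hsum : ∑ k, Z i k ≠ 0 := by
    have : ∑ k, Z i k = S.card * ∑ k, X i k := by
      simp_rw [hZa]
      rw [Finset.sum_comm, ← nsmul_eq_mul, ← Finset.sum_const]
      refine Finset.sum_congr rfl fun σ hσ => ?_
      simp only [hS, Finset.mem_filter, Finset.mem_univ, true_and] at hσ
      rw [hσ]
      exact Equiv.sum_comp σ (fun k => X i k)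
    rw [this]
    refine mul_ne_zero ?_ h1
    have : (1 : Equiv.Perm (Fin d)) ∈ S := by simp [hS]
    exact_mod_cast (Finset.card_pos.mpr ⟨_, this⟩).ne'
  obtain ⟨k, -, hk⟩ := Finset.exists_ne_zero_of_sum_ne_zero hsum
  have hdiag : ∀ a, Z a a = 0 := fun a => by linarith [hZs a a]
  have hki : k ≠ i := by rintro rfl; exact hk (hdiag _)
  have h0 : ∀ a b, a ≠ i → b ≠ i → Z a b = 0 := by
    intro a b ha hb
    have := hinv (Equiv.swap a b) (Equiv.swap_apply_of_ne_of_ne ha.symm hb.symm) a b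
    rw [Equiv.swap_apply_left, Equiv.swap_apply_right] at this
    linarith [hZs a b]
  have h2 : ∀ a, a ≠ i → Z i a = Z i k := by
    intro a ha
    have hs := Equiv.swap_apply_of_ne_of_ne hki.symm ha.symm
    have := hinv (Equiv.swap k a) hs i k
    rwa [hs, Equiv.swap_apply_left] at this
  have : TT i = (Z i k)⁻¹ • Z := by
    ext a b
    simp only [TT, Matrix.of_apply, Matrix.smul_apply, smul_eq_mul]
    by_cases ha : a = i <;> by_cases hb : b = i
    · subst ha; subst hb; simp [hdiag]
    · subst ha; simp [hb, h2 b hb, hk]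
    · subst hb; rw [hZs a, h2 a ha]; simp [ha, hk]
    · simp [ha, hb, h0 a b ha hb]
  rw [this]
  exact V.smul_mem _ hZV

theorem alg_E {d : ℕ} (V : Submodule ℝ (Matrix (Fin d) (Fin d) ℝ))
    (hbr : ∀ X Y, X ∈ V → Y ∈ V → X * Y - Y * X ∈ V)
    (hperm : ∀ (π : Equiv.Perm (Fin d)) X, X ∈ V → X.submatrix π π ∈ V)
    (X : Matrix (Fin d) (Fin d) ℝ) (hX : X ∈ V) (hskew : ∀ a b, X a b = - X b a)
    (i : Fin d) (h1 : ∑ k, X i k ≠ 0) (a b : Fin d) :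
    Matrix.single a b (1:ℝ) - Matrix.single b a 1 ∈ V := by
  classical
  have hT : ∀ j, TT j ∈ V := by
    intro j
    have := hperm (Equiv.swap i j) _ (alg_T V hperm X hX hskew i h1)
    convert this using 1
    ext x y
    simp only [TT, Matrix.of_apply, Matrix.submatrix_apply]
    have : ∀ x, (Equiv.swap i j x = i) = (x = j) := fun x => by
      rw [Equiv.swap_apply_eq_iff, Equiv.swap_apply_left]
    simp only [this]
  have key : Matrix.single a b (1:ℝ) - Matrix.single b a 1
      = (d:ℝ)⁻¹ • (TT a - TT b - (TT a * TT b - TT b * TT a)) := by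
    have hd : (d:ℝ) ≠ 0 := by
      have := a.pos; positivity
    rw [eq_inv_smul_iff₀ hd]
    ext x y
    simp only [TT, Matrix.of_apply, Matrix.smul_apply, Matrix.sub_apply, Matrix.mul_apply,
      Matrix.single_apply, smul_eq_mul, sub_mul, mul_sub, Finset.sum_sub_distrib]
    simp
    grind
  rw [key]
  exact V.smul_mem _ (V.sub_mem (V.sub_mem (hT a) (hT b)) (hbr _ _ (hT a) (hT b)))

theorem oneparam {𝔸 : Type*} [NormedRing 𝔸] [NormedAlgebra ℝ 𝔸] [CompleteSpace 𝔸]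
    (U : ℝ → 𝔸) (hc : Continuous U) (h0 : U 0 = 1) (hadd : ∀ s t, U (s + t) = U s * U t) :
    ∃ X, ∀ t, HasDerivAt U (U t * X) t := by
  set M : ℝ → 𝔸 := fun a => ∫ s in (0:ℝ)..a, U s with hM
  have hMd : ∀ a, HasDerivAt M (U a) a := fun a =>
    intervalIntegral.integral_hasDerivAt_right (hc.intervalIntegrable _ _)
      (hc.stronglyMeasurableAtFilter _ _) hc.continuousAt
  have hM0 : M 0 = 0 := by simp [hM]
  have htend : Filter.Tendsto (fun a : ℝ => a⁻¹ • M a) (nhdsWithin 0 {0}ᶜ) (nhds 1) := by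
    have := (hMd 0).tendsto_slope_zero
    simpa [hM0, h0] using this
  have hev : ∀ᶠ a : ℝ in nhdsWithin 0 {0}ᶜ, IsUnit (a⁻¹ • M a) :=
    htend.eventually (Units.isOpen.mem_nhds isUnit_one)
  obtain ⟨a, ha, ha0⟩ := (hev.and self_mem_nhdsWithin).exists
  have ha0 : a ≠ 0 := ha0
  have hu : IsUnit (M a) := by
    have h2 : M a = (algebraMap ℝ 𝔸 a) * (a⁻¹ • M a) := by
      rw [← Algebra.smul_def, smul_smul, mul_inv_cancel₀ ha0, one_smul]
    rw [h2]
    exact ((isUnit_iff_ne_zero.mpr ha0).map (algebraMap ℝ 𝔸)).mul ha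
  obtain ⟨m, hm⟩ := hu
  have hint : ∀ t, U t * M a = M (t + a) - M t := by
    intro t
    simp only [hM]
    rw [intervalIntegral.integral_interval_sub_left (hc.intervalIntegrable _ _)
      (hc.intervalIntegrable _ _)]
    have := (ContinuousLinearMap.mul ℝ 𝔸 (U t)).intervalIntegral_comp_comm
      (hc.intervalIntegrable (μ := volume) 0 a)
    simp only [ContinuousLinearMap.mul_apply'] at this
    rw [← this]
    simp_rw [← hadd]
    rw [intervalIntegral.integral_comp_add_left]
    simp
  have hUe : U = fun t => (M (t + a) - M t) * (↑m⁻¹ : 𝔸) := by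
    funext t
    rw [← hint, ← hm, mul_assoc, Units.mul_inv, mul_one]
  refine ⟨(U a - 1) * (↑m⁻¹ : 𝔸), fun t => ?_⟩
  have h1 : HasDerivAt (fun t => M (t + a)) (U (t + a)) t := (hMd (t + a)).comp_add_const t a
  have := (h1.sub (hMd t)).mul_const (↑m⁻¹ : 𝔸)
  have h3 : U t * ((U a - 1) * (↑m⁻¹ : 𝔸)) = (U (t + a) - U t) * (↑m⁻¹ : 𝔸) := by
    rw [hadd]; noncomm_ring
  rw [h3]
  have h4 : U = fun y => ((fun t => M (t + a)) - M) y * (↑m⁻¹ : 𝔸) := by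
    rw [hUe]; rfl
  rw [← h4] at this
  exact this

/-- Infinitesimal symmetries of `F`. -/
def VV {d : ℕ} (F : EuclideanSpace ℝ (Fin d) → ℂ) : Submodule ℝ (Matrix (Fin d) (Fin d) ℝ) where
  carrier := {X | ∀ ξ, fderiv ℝ F ξ (toEuclideanCLM (𝕜 := ℝ) X ξ) = 0}
  add_mem' := by
    intro X Y hX hY ξ
    rw [map_add, _root_.add_apply, map_add, hX, hY, add_zero]
  zero_mem' := by intro ξ; simp
  smul_mem' := by
    intro c X hX ξ
    rw [map_smul, _root_.smul_apply, map_smul, hX, smul_zero]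

theorem VV_bracket {d : ℕ} (F : EuclideanSpace ℝ (Fin d) → ℂ) (hF : ContDiff ℝ 2 F)
    (X Y : Matrix (Fin d) (Fin d) ℝ) (hX : X ∈ VV F) (hY : Y ∈ VV F) :
    X * Y - Y * X ∈ VV F := by
  have hd : Differentiable ℝ (fderiv ℝ F) :=
    (hF.fderiv_right (m := 1) (by norm_num)).differentiable (by norm_num)
  have key : ∀ X ∈ VV F, ∀ ξ v, fderiv ℝ (fderiv ℝ F) ξ v (toEuclideanCLM (𝕜 := ℝ) X ξ)
      + fderiv ℝ F ξ (toEuclideanCLM (𝕜 := ℝ) X v) = 0 := by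
    intro X hX ξ v
    have h1 := (hd ξ).hasFDerivAt.clm_apply (toEuclideanCLM (𝕜 := ℝ) X).hasFDerivAt
    have h2 : (fun y => fderiv ℝ F y (toEuclideanCLM (𝕜 := ℝ) X y)) = fun _ => 0 := funext hX
    rw [h2] at h1
    have h3 := h1.unique (hasFDerivAt_const 0 ξ)
    have := congrArg (fun L => L v) h3
    simp at this
    rw [add_comm]; exact this
  intro ξ
  have hs : IsSymmSndFDerivAt ℝ F ξ := hF.contDiffAt.isSymmSndFDerivAt (by simp)
  have a1 := key X hX ξ (toEuclideanCLM (𝕜 := ℝ) Y ξ)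
  have a2 := key Y hY ξ (toEuclideanCLM (𝕜 := ℝ) X ξ)
  rw [hs.eq] at a1
  simp only [map_sub, map_mul, _root_.sub_apply, ContinuousLinearMap.mul_apply']
  have := congrArg₂ (· - ·) a1 a2
  simpa using this

theorem VV_perm {d : ℕ} (F : EuclideanSpace ℝ (Fin d) → ℂ) (hF : ContDiff ℝ 2 F)
    (hP : ∀ (π : Equiv.Perm (Fin d)) ξ, F (toEuclideanCLM (𝕜 := ℝ) (π.permMatrix ℝ) ξ) = F ξ)
    (π : Equiv.Perm (Fin d)) (X : Matrix (Fin d) (Fin d) ℝ) (hX : X ∈ VV F) :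
    X.submatrix π π ∈ VV F := by
  intro ξ
  have hd : Differentiable ℝ F := hF.differentiable (by norm_num)
  set P := toEuclideanCLM (𝕜 := ℝ) ((π⁻¹).permMatrix ℝ)
  have h1 : (F ∘ P) = F := funext (hP _)
  have h2 : fderiv ℝ F ξ = (fderiv ℝ F (P ξ)).comp P := by
    conv_lhs => rw [← h1]
    rw [fderiv_comp ξ (hd _) P.differentiableAt, P.fderiv]
  rw [h2, ContinuousLinearMap.comp_apply]
  have h3 : P (toEuclideanCLM (𝕜 := ℝ) (X.submatrix π π) ξ) = toEuclideanCLM (𝕜 := ℝ) X (P ξ) := by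
    ext i
    simp only [P, ofLp_toEuclideanCLM]
    rw [Matrix.permMatrix_mulVec, Matrix.permMatrix_mulVec]
    simp only [Matrix.mulVec, dotProduct, Function.comp, Matrix.submatrix_apply]
    rw [← Equiv.sum_comp π (fun j => X i j * (ξ.ofLp) (π⁻¹ j))]
    simp
  rw [h3]
  exact hX _

/-- the rotation path. -/
theorem exists_rot {d : ℕ} (hd : 2 ≤ d) (x y : EuclideanSpace ℝ (Fin d)) (hxy : ‖x‖ = ‖y‖) :
    ∃ (w : EuclideanSpace ℝ (Fin d)) (t : ℝ), ‖w‖ = ‖x‖ ∧ inner ℝ x w = 0 ∧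
      y = Real.cos t • x + Real.sin t • w := by
  by_cases hx : x = 0
  · subst hx
    have : y = 0 := by simpa using hxy.symm
    exact ⟨0, 0, by simp [this]⟩
  have hx0 : ‖x‖ ≠ 0 := by simpa using hx
  set c : ℝ := inner ℝ x y / ‖x‖ ^ 2 with hc
  set z := y - c • x with hz
  have hxz : inner ℝ x z = 0 := by
    rw [hz, inner_sub_right, inner_smul_right, real_inner_self_eq_norm_sq, hc]
    field_simp; ring
  have hyz : y = c • x + z := by rw [hz]; abel
  have hn : c ^ 2 * ‖x‖ ^ 2 + ‖z‖ ^ 2 = ‖x‖ ^ 2 := by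
    have : ‖y‖ ^ 2 = c ^ 2 * ‖x‖ ^ 2 + ‖z‖ ^ 2 := by
      rw [hyz, norm_add_sq_real, inner_smul_left, hxz, norm_smul, mul_pow]
      simp
    rw [← this, hxy]
  have hcle : c ^ 2 ≤ 1 := by
    have : 0 < ‖x‖ ^ 2 := by positivity
    nlinarith [sq_nonneg ‖z‖]
  have hcl := abs_le_one_iff_mul_self_le_one.mpr (by nlinarith : c * c ≤ 1)
  have hc1 := (abs_le.mp hcl).1
  have hc2 := (abs_le.mp hcl).2
  have hsin : Real.sin (Real.arccos c) * ‖x‖ = ‖z‖ := by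
    rw [Real.sin_arccos]
    have : 1 - c ^ 2 = (‖z‖ / ‖x‖) ^ 2 := by field_simp; linarith
    rw [this, Real.sqrt_sq (by positivity)]
    field_simp
  by_cases hz0 : z = 0
  · have : ∃ w : EuclideanSpace ℝ (Fin d), w ≠ 0 ∧ inner ℝ x w = 0 := by
      have hfr : Module.finrank ℝ (ℝ ∙ x)ᗮ ≠ 0 := by
        have h1 := (ℝ ∙ x).finrank_add_finrank_orthogonal
        rw [finrank_span_singleton hx, finrank_euclideanSpace_fin] at h1
        omega
      have : Nontrivial (ℝ ∙ x)ᗮ := Module.nontrivial_of_finrank_pos (R := ℝ) (by omega)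
      obtain ⟨w, hw⟩ := exists_ne (0 : (ℝ ∙ x)ᗮ)
      exact ⟨w, by simpa using hw, (Submodule.mem_orthogonal_singleton_iff_inner_right).mp w.2⟩
    obtain ⟨w, hw0, hw⟩ := this
    refine ⟨(‖x‖ / ‖w‖) • w, Real.arccos c, ?_, ?_, ?_⟩
    · have : ‖w‖ ≠ 0 := by simpa using hw0
      rw [norm_smul, norm_div, norm_norm, norm_norm]; field_simp
    · rw [inner_smul_right, hw, mul_zero]
    · have : Real.sin (Real.arccos c) = 0 := by
        rw [hz0, norm_zero] at hsin
        exact (mul_eq_zero.mp hsin).resolve_right hx0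
      rw [this, Real.cos_arccos hc1 hc2, hyz, hz0]; simp
  · have hzn : ‖z‖ ≠ 0 := by simpa using hz0
    refine ⟨(‖x‖ / ‖z‖) • z, Real.arccos c, ?_, ?_, ?_⟩
    · rw [norm_smul, norm_div, norm_norm, norm_norm]; field_simp
    · rw [inner_smul_right, hxz, mul_zero]
    · rw [smul_smul, Real.cos_arccos hc1 hc2, ← mul_div_assoc, hsin, div_self hzn, one_smul, ← hyz]

theorem VV_radial {d : ℕ} (hd : 2 ≤ d) (F : EuclideanSpace ℝ (Fin d) → ℂ) (hF : ContDiff ℝ 2 F)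
    (hE : ∀ a b : Fin d, Matrix.single a b (1:ℝ) - Matrix.single b a 1 ∈ VV F)
    (x y : EuclideanSpace ℝ (Fin d)) (hxy : ‖x‖ = ‖y‖) : F x = F y := by
  have hdf : Differentiable ℝ F := hF.differentiable (by norm_num)
  obtain ⟨w, t₀, hw, hxw, hy⟩ := exists_rot hd x y hxy
  by_cases hx : x = 0
  · subst hx
    have : y = 0 := by simpa using hxy.symm
    rw [this]
  have hx0 : ‖x‖ ≠ 0 := by simpa using hx
  have hmem : ∀ u v : Fin d → ℝ, vecMulVec u v - vecMulVec v u ∈ VV F := by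
    intro u v
    have : vecMulVec u v - vecMulVec v u
        = ∑ a, ∑ b, (u a * v b) • (Matrix.single a b (1:ℝ) - Matrix.single b a 1) := by
      ext i j
      simp only [Matrix.sub_apply, vecMulVec_apply, Matrix.sum_apply, Matrix.smul_apply,
        Matrix.single_apply, smul_eq_mul, mul_sub, Finset.sum_sub_distrib]
      simp [ite_and, Finset.sum_ite_eq, mul_comm]
    rw [this]
    exact Submodule.sum_mem _ fun a _ => Submodule.sum_mem _ fun b _ => Submodule.smul_mem _ _ (hE a b)
  have happ : ∀ ξ : EuclideanSpace ℝ (Fin d),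
      toEuclideanCLM (𝕜 := ℝ) (vecMulVec w.ofLp x.ofLp - vecMulVec x.ofLp w.ofLp) ξ
      = inner ℝ x ξ • w - inner ℝ w ξ • x := by
    intro ξ
    ext i
    simp [Matrix.sub_mulVec, vecMulVec_mulVec, EuclideanSpace.inner_eq_star_dotProduct,
      dotProduct_comm]
    ring
  have hd1 : ∀ t : ℝ, HasDerivAt (fun t : ℝ => F (Real.cos t • x + Real.sin t • w)) 0 t := by
    intro t
    have h1 : HasDerivAt (fun t : ℝ => Real.cos t • x + Real.sin t • w)
        ((-Real.sin t) • x + Real.cos t • w) t :=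
      ((Real.hasDerivAt_cos t).smul_const x).add ((Real.hasDerivAt_sin t).smul_const w)
    have h2 := (hdf (Real.cos t • x + Real.sin t • w)).hasFDerivAt.comp_hasDerivAt t h1
    have h3 := hmem w.ofLp x.ofLp (Real.cos t • x + Real.sin t • w)
    rw [happ] at h3
    have h4 : (-Real.sin t) • x + Real.cos t • w = (‖x‖ ^ 2)⁻¹ •
      (inner ℝ x (Real.cos t • x + Real.sin t • w) • w
        - inner ℝ w (Real.cos t • x + Real.sin t • w) • x) := by
      simp only [inner_add_right, inner_smul_right, hxw, real_inner_comm x w,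
        real_inner_self_eq_norm_sq, hw, mul_zero, add_zero, zero_add]
      rw [smul_sub, smul_smul, smul_smul]
      have : (‖x‖ ^ 2)⁻¹ * (Real.cos t * ‖x‖ ^ 2) = Real.cos t := by field_simp
      rw [this]
      have : (‖x‖ ^ 2)⁻¹ * (Real.sin t * ‖x‖ ^ 2) = Real.sin t := by field_simp
      rw [this, neg_smul]; abel
    rw [h4, map_smul, h3, smul_zero] at h2
    exact h2
  have := is_const_of_deriv_eq_zero (fun t => (hd1 t).differentiableAt) (fun t => (hd1 t).deriv) 0 t₀
  simpa [← hy] using this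

theorem uniform_prob {d : ℕ} (hd : 2 ≤ d) : IsProbabilityMeasure (uniformSphere d) := by
  have : NeZero d := ⟨by omega⟩
  have hne : (volume : Measure (EuclideanSpace ℝ (Fin d))).toSphere ≠ 0 :=
    Measure.toSphere_ne_zero _
  constructor
  rw [uniformSphere, Measure.smul_apply, smul_eq_mul]
  exact ENNReal.inv_mul_cancel (mt Measure.measure_univ_eq_zero.mp hne) (measure_ne_top _ _)

theorem uniform_inv {d : ℕ} (L : EuclideanSpace ℝ (Fin d) ≃ₗᵢ[ℝ] EuclideanSpace ℝ (Fin d)) :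
    Measure.map L (Measure.map (Subtype.val : Metric.sphere (0 : EuclideanSpace ℝ (Fin d)) 1 →
      EuclideanSpace ℝ (Fin d)) (uniformSphere d)) = Measure.map (Subtype.val : Metric.sphere (0 : EuclideanSpace ℝ (Fin d)) 1 →
      EuclideanSpace ℝ (Fin d)) (uniformSphere d) := by
  have hLm : Measurable L := L.continuous.measurable
  ext s hs
  rw [Measure.map_apply hLm hs, Measure.map_apply measurable_subtype_coe (hLm hs),
    Measure.map_apply measurable_subtype_coe hs]
  simp only [uniformSphere, Measure.smul_apply]
  congr 1
  rw [Measure.toSphere_apply' _ (measurable_subtype_coe (hLm hs)),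
    Measure.toSphere_apply' _ (measurable_subtype_coe hs)]
  congr 1
  symm
  rw [← (L.measurePreserving).measure_preimage_equiv (f := L.toHomeomorph.toMeasurableEquiv)]
  congr 1
  ext x
  simp only [Set.mem_smul, Set.mem_preimage, Subtype.image_preimage_coe, Set.mem_inter_iff]
  constructor
  · rintro ⟨r, hr, y, ⟨hy1, hy2⟩, hy3⟩
    refine ⟨r, hr, L.symm y, ⟨by simpa using hy1, by simpa using hy2⟩, ?_⟩
    have : L x = r • y := hy3.symm
    rw [← map_smul, ← this, L.symm_apply_apply]
  · rintro ⟨r, hr, y, ⟨hy1, hy2⟩, rfl⟩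
    refine ⟨r, hr, L y, ⟨by simpa using hy1, hy2⟩, ?_⟩
    exact (L.map_smul r y).symm

theorem charFun_map_iso {d : ℕ} (μ : Measure (EuclideanSpace ℝ (Fin d)))
    (L : EuclideanSpace ℝ (Fin d) ≃ₗᵢ[ℝ] EuclideanSpace ℝ (Fin d)) (h : Measure.map L μ = μ) (ξ) :
    charFun μ (L ξ) = charFun μ ξ := by
  conv_lhs => rw [← h]
  rw [charFun_apply, charFun_apply, integral_map L.continuous.measurable.aemeasurable]
  · simp only [LinearIsometryEquiv.inner_map_map]
  · exact (by fun_prop : Continuous _).aestronglyMeasurable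

theorem eq_of_radial {d : ℕ} (μ ν : Measure (EuclideanSpace ℝ (Fin d)))
    [IsProbabilityMeasure μ] [IsProbabilityMeasure ν]
    (hμs : μ (Metric.sphere (0 : EuclideanSpace ℝ (Fin d)) 1)ᶜ = 0)
    (hνs : ν (Metric.sphere (0 : EuclideanSpace ℝ (Fin d)) 1)ᶜ = 0)
    (hμ : ∀ x y, ‖x‖ = ‖y‖ → charFun μ x = charFun μ y)
    (hν : ∀ x y, ‖x‖ = ‖y‖ → charFun ν x = charFun ν y) : μ = ν := by
  apply Measure.ext_of_charFun
  funext ξ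
  have hae : ∀ (ρ : Measure (EuclideanSpace ℝ (Fin d))),
      ρ (Metric.sphere (0 : EuclideanSpace ℝ (Fin d)) 1)ᶜ = 0 → ∀ᵐ x ∂ρ, ‖x‖ = 1 := by
    intro ρ h
    filter_upwards [compl_mem_ae_iff.mpr h] with x hx
    simpa using hx
  have h1 : ∀ (ρ σ : Measure (EuclideanSpace ℝ (Fin d))) [IsProbabilityMeasure σ],
      σ (Metric.sphere (0 : EuclideanSpace ℝ (Fin d)) 1)ᶜ = 0 → 
      (∀ x y, ‖x‖ = ‖y‖ → charFun ρ x = charFun ρ y) →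
      charFun ρ ξ = ∫ y, ∫ x, Complex.exp ((inner ℝ x (‖ξ‖ • y) : ℝ) * Complex.I) ∂ρ ∂σ := by
    intro ρ σ _ hσ hρ
    have : (fun y => charFun ρ (‖ξ‖ • y)) =ᵐ[σ] fun _ => charFun ρ ξ := by
      filter_upwards [hae σ hσ] with y hy
      apply hρ
      rw [norm_smul, hy, norm_norm, mul_one]
    have h2 := integral_congr_ae this
    simp only [integral_const, probReal_univ, one_smul] at h2
    rw [← h2]
    rfl
  rw [h1 μ ν hνs hμ, h1 ν μ hμs hν]
  rw [integral_integral_swap]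
  · simp only [inner_smul_right, real_inner_comm]
  · refine Integrable.of_bound (C := 1) (by fun_prop : Continuous _).aestronglyMeasurable ?_
    refine Filter.Eventually.of_forall fun p => ?_
    simp only [Function.uncurry]
    rw [Complex.norm_exp_ofReal_mul_I]

theorem uniform_radial {d : ℕ} (x y : EuclideanSpace ℝ (Fin d)) (h : ‖x‖ = ‖y‖) :
    charFun (Measure.map (Subtype.val : Metric.sphere (0 : EuclideanSpace ℝ (Fin d)) 1 →
      EuclideanSpace ℝ (Fin d)) (uniformSphere d)) x = charFun (Measure.map (Subtype.val : Metric.sphere (0 : EuclideanSpace ℝ (Fin d)) 1 →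
      EuclideanSpace ℝ (Fin d)) (uniformSphere d)) y := by
  have := charFun_map_iso _ _ (uniform_inv ((ℝ ∙ (x - y))ᗮ.reflection)) x
  rw [Submodule.reflection_sub h] at this
  exact this.symm

theorem charFun_smooth {d : ℕ} (μ : Measure (EuclideanSpace ℝ (Fin d))) [IsProbabilityMeasure μ]
    (hμs : μ (Metric.sphere (0 : EuclideanSpace ℝ (Fin d)) 1)ᶜ = 0) : ContDiff ℝ 2 (charFun μ) := by
  have : MemLp id ((2:ℕ) : ENNReal) μ := by
    refine MemLp.of_bound (C := 1) (by fun_prop) ?_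
    filter_upwards [compl_mem_ae_iff.mpr hμs] with x hx
    simp at hx
    simp [hx]
  exact_mod_cast contDiff_charFun this

theorem clm_inj {n : ℕ} (A B : Matrix (Fin n) (Fin n) ℝ)
    (h : ∀ x, toEuclideanCLM (𝕜 := ℝ) A x = toEuclideanCLM (𝕜 := ℝ) B x) : A = B :=
  EquivLike.injective (toEuclideanCLM (n := Fin n) (𝕜 := ℝ)) (ContinuousLinearMap.ext h)

theorem exists_orthIso {n : ℕ} (A : Matrix (Fin n) (Fin n) ℝ)
    (hA : A ∈ Matrix.orthogonalGroup (Fin n) ℝ) :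
    ∃ L : EuclideanSpace ℝ (Fin n) ≃ₗᵢ[ℝ] EuclideanSpace ℝ (Fin n),
      ∀ x, L x = toEuclideanCLM (𝕜 := ℝ) A x := by
  have h : toEuclideanCLM (𝕜 := ℝ) A ∈ unitary _ := Unitary.map_mem (toEuclideanCLM (𝕜 := ℝ)) hA
  exact ⟨Unitary.linearIsometryEquiv ⟨_, h⟩, fun x => rfl⟩

/-- Rotation by angle `s` in the plane of `v, w`. -/
noncomputable def rot {n : ℕ} (v w : Fin n → ℝ) (s : ℝ) : Matrix (Fin n) (Fin n) ℝ :=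
  1 + (Real.cos s - 1) • (vecMulVec v v + vecMulVec w w)
    + Real.sin s • (vecMulVec w v - vecMulVec v w)

theorem rot_add {n : ℕ} (v w : Fin n → ℝ) (hv : v ⬝ᵥ v = 1) (hw : w ⬝ᵥ w = 1) (hvw : v ⬝ᵥ w = 0)
    (s t : ℝ) : rot v w (s + t) = rot v w s * rot v w t := by
  have hwv : w ⬝ᵥ v = 0 := by rw [dotProduct_comm, hvw]
  have hPP : (vecMulVec v v + vecMulVec w w) * (vecMulVec v v + vecMulVec w w)
      = vecMulVec v v + vecMulVec w w := by
    simp [add_mul, mul_add, vecMulVec_mul_vecMulVec, hv, hw, hvw, hwv]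
  have hPJ : (vecMulVec v v + vecMulVec w w) * (vecMulVec w v - vecMulVec v w)
      = vecMulVec w v - vecMulVec v w := by
    simp [add_mul, mul_sub, vecMulVec_mul_vecMulVec, hv, hw, hvw, hwv]
  have hJP : (vecMulVec w v - vecMulVec v w) * (vecMulVec v v + vecMulVec w w)
      = vecMulVec w v - vecMulVec v w := by
    simp [sub_mul, mul_add, vecMulVec_mul_vecMulVec, hv, hw, hvw, hwv]
    abel
  have hJJ : (vecMulVec w v - vecMulVec v w) * (vecMulVec w v - vecMulVec v w)
      = -(vecMulVec v v + vecMulVec w w) := by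
    simp [sub_mul, mul_sub, vecMulVec_mul_vecMulVec, hv, hw, hvw, hwv]
    abel
  unfold rot
  generalize vecMulVec v v + vecMulVec w w = P at *
  generalize vecMulVec w v - vecMulVec v w = J at *
  simp only [add_mul, mul_add, one_mul, mul_one, smul_mul_assoc, mul_smul_comm, hPP, hPJ, hJP, hJJ,
    Real.cos_add, Real.sin_add]
  module

theorem rot_zero {n : ℕ} (v w : Fin n → ℝ) : rot v w 0 = 1 := by
  simp [rot]

theorem rot_transpose {n : ℕ} (v w : Fin n → ℝ) (s : ℝ) : (rot v w s)ᵀ = rot v w (-s) := by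
  simp only [rot, transpose_add, transpose_smul, transpose_sub, transpose_vecMulVec, transpose_one,
    Real.cos_neg, Real.sin_neg]
  module

theorem rot_mem {n : ℕ} (v w : Fin n → ℝ) (hv : v ⬝ᵥ v = 1) (hw : w ⬝ᵥ w = 1) (hvw : v ⬝ᵥ w = 0)
    (s : ℝ) : rot v w s ∈ Matrix.orthogonalGroup (Fin n) ℝ := by
  rw [Matrix.mem_orthogonalGroup_iff, rot_transpose, ← rot_add v w hv hw hvw, add_neg_cancel, rot_zero]

theorem rot_det {n : ℕ} (v w : Fin n → ℝ) (hv : v ⬝ᵥ v = 1) (hw : w ⬝ᵥ w = 1) (hvw : v ⬝ᵥ w = 0)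
    (s : ℝ) : (rot v w s).det = 1 := by
  have h1 : rot v w s = rot v w (s/2) * rot v w (s/2) := by
    rw [← rot_add v w hv hw hvw, add_halves]
  have h2 : rot v w (s/2) * (rot v w (s/2))ᵀ = 1 := by
    rw [rot_transpose, ← rot_add v w hv hw hvw, add_neg_cancel, rot_zero]
  have h3 := congrArg det h2
  rw [det_mul, det_transpose, det_one] at h3
  rw [h1, det_mul, h3]

/-- The rotation as an element of `SO n`. -/
noncomputable def rotSO {n : ℕ} (v w : Fin n → ℝ) (hv : v ⬝ᵥ v = 1) (hw : w ⬝ᵥ w = 1)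
    (hvw : v ⬝ᵥ w = 0) (s : ℝ) : SO n :=
  ⟨⟨rot v w s, rot_mem v w hv hw hvw s⟩, rot_det v w hv hw hvw s⟩

theorem rotSO_add {n : ℕ} (v w : Fin n → ℝ) (hv : v ⬝ᵥ v = 1) (hw : w ⬝ᵥ w = 1)
    (hvw : v ⬝ᵥ w = 0) (s t : ℝ) : rotSO v w hv hw hvw (s + t)
      = rotSO v w hv hw hvw s * rotSO v w hv hw hvw t :=
  Subtype.ext (Subtype.ext (rot_add v w hv hw hvw s t))

theorem rotSO_zero {n : ℕ} (v w : Fin n → ℝ) (hv : v ⬝ᵥ v = 1) (hw : w ⬝ᵥ w = 1)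
    (hvw : v ⬝ᵥ w = 0) : rotSO v w hv hw hvw 0 = 1 :=
  Subtype.ext (Subtype.ext (rot_zero v w))

theorem rotSO_continuous {n : ℕ} (v w : Fin n → ℝ) (hv : v ⬝ᵥ v = 1) (hw : w ⬝ᵥ w = 1)
    (hvw : v ⬝ᵥ w = 0) : Continuous (rotSO v w hv hw hvw) := by
  refine Continuous.subtype_mk (Continuous.subtype_mk ?_ _) _
  unfold rot
  fun_prop

/-- Householder reflection. -/
noncomputable def HH {n : ℕ} (u : Fin n → ℝ) : Matrix (Fin n) (Fin n) ℝ :=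
  1 - (2:ℝ) • vecMulVec u u

theorem HH_mul {n : ℕ} (v w : Fin n → ℝ) (hv : v ⬝ᵥ v = 1)
    (hvw : v ⬝ᵥ w = 0) (t : ℝ) :
    HH (Real.cos t • v + Real.sin t • w) * HH v = rot v w (2 * t) := by
  have hwv : w ⬝ᵥ v = 0 := by rw [dotProduct_comm, hvw]
  simp only [HH, sub_mul, mul_sub, one_mul, mul_one, smul_mul_assoc, mul_smul_comm,
    vecMulVec_mul_vecMulVec, add_dotProduct, smul_dotProduct, hv, hwv]
  ext i j
  simp only [rot, Matrix.sub_apply, Matrix.add_apply, Matrix.smul_apply, vecMulVec_apply,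
    Pi.add_apply, Pi.smul_apply, smul_eq_mul, Real.cos_two_mul, Real.sin_two_mul]
  linear_combination (-2 * w i * w j) * Real.sin_sq_add_cos_sq t

theorem HH_det {n : ℕ} (u : Fin n → ℝ) (hu : u ⬝ᵥ u = 1) : (HH u).det = -1 := by
  have : HH u = 1 + replicateCol Unit ((-2:ℝ) • u) * replicateRow Unit u := by
    ext i j
    simp [HH, vecMulVec_apply, Matrix.mul_apply, sub_eq_add_neg, mul_assoc]
  rw [this, det_one_add_replicateCol_mul_replicateRow, dotProduct_smul, hu]
  norm_num

theorem HH_refl {n : ℕ} (u : EuclideanSpace ℝ (Fin n)) (hu : u ≠ 0) :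
    ∀ x, (ℝ ∙ u)ᗮ.reflection x = toEuclideanCLM (𝕜 := ℝ) (HH ((‖u‖⁻¹ • u).ofLp)) x := by
  intro x
  have hu0 : ‖u‖ ≠ 0 := by simpa using hu
  rw [Submodule.reflection_orthogonal_apply, Submodule.reflection_singleton_apply]
  ext i
  simp [HH, vecMulVec_mulVec, EuclideanSpace.inner_eq_star_dotProduct, dotProduct_comm,
    Matrix.sub_mulVec, Matrix.smul_mulVec]
  field_simp

theorem dot_inner {n : ℕ} (u v : EuclideanSpace ℝ (Fin n)) : u.ofLp ⬝ᵥ v.ofLp = inner ℝ u v := by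
  simp [EuclideanSpace.inner_eq_star_dotProduct, dotProduct_comm]

theorem SO_gen {n : ℕ} (hn : 2 ≤ n) (N : Subgroup (SO n))
    (hN : ∀ v w hv hw hvw s, rotSO v w hv hw hvw s ∈ N) (g : SO n) : g ∈ N := by
  have hpair : ∀ u v : Fin n → ℝ, u ⬝ᵥ u = 1 → v ⬝ᵥ v = 1 → ∃ h ∈ N, SOmat h = HH u * HH v := by
    intro u v hu hv
    have hnorm : ∀ z : Fin n → ℝ, z ⬝ᵥ z = 1 → ‖WithLp.toLp 2 z‖ = 1 := by
      intro z hz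
      have := dot_inner (WithLp.toLp 2 z) (WithLp.toLp 2 z)
      rw [real_inner_self_eq_norm_sq] at this
      have h2 : ‖WithLp.toLp 2 z‖ ^ 2 = 1 := by rw [← this]; exact hz
      nlinarith [norm_nonneg (WithLp.toLp 2 z)]
    obtain ⟨w, t, hw, hvw, huv⟩ := exists_rot hn (WithLp.toLp 2 v) (WithLp.toLp 2 u)
      (by rw [hnorm _ hu, hnorm _ hv])
    have hw1 : w.ofLp ⬝ᵥ w.ofLp = 1 := by
      rw [dot_inner, real_inner_self_eq_norm_sq, hw, hnorm _ hv, one_pow]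
    have hvw1 : v ⬝ᵥ w.ofLp = 0 := by
      rw [← hvw, ← dot_inner]
    have hu' : u = Real.cos t • v + Real.sin t • w.ofLp := congrArg WithLp.ofLp huv
    refine ⟨_, hN v w.ofLp hv hw1 hvw1 (2 * t), ?_⟩
    rw [hu', HH_mul _ _ hv hvw1]
    rfl
  have hlist : ∀ l : List (EuclideanSpace ℝ (Fin n)), ∃ M : Matrix (Fin n) (Fin n) ℝ,
      (∀ x, (l.map fun v => (ℝ ∙ v)ᗮ.reflection).prod x = toEuclideanCLM (𝕜 := ℝ) M x) ∧
      ((∃ h ∈ N, SOmat h = M) ∨ ∀ u, u ⬝ᵥ u = 1 → ∃ h ∈ N, SOmat h = HH u * M) := by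
    intro l
    induction l with
    | nil => exact ⟨1, fun x => by simp, Or.inl ⟨1, N.one_mem, rfl⟩⟩
    | cons v l ih =>
      obtain ⟨M, hM, hor⟩ := ih
      by_cases hv : v = 0
      · refine ⟨M, fun x => ?_, hor⟩
        rw [List.map_cons, List.prod_cons, LinearIsometryEquiv.coe_mul, Function.comp_apply, hM, hv]
        rw [Submodule.reflection_eq_self_iff]
        simp
      · have hv1 : (‖v‖⁻¹ • v).ofLp ⬝ᵥ (‖v‖⁻¹ • v).ofLp = 1 := by
          rw [dot_inner, real_inner_self_eq_norm_sq, norm_smul, norm_inv, norm_norm,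
            inv_mul_cancel₀ (by simpa using hv), one_pow]
        refine ⟨HH ((‖v‖⁻¹ • v).ofLp) * M, fun x => ?_, ?_⟩
        · rw [List.map_cons, List.prod_cons, LinearIsometryEquiv.coe_mul, Function.comp_apply, hM, HH_refl v hv, map_mul]
          rfl
        · rcases hor with ⟨h, hh, hhM⟩ | hor
          · right
            intro u hu
            obtain ⟨h', hh', hhM'⟩ := hpair u _ hu hv1
            refine ⟨h' * h, N.mul_mem hh' hh, ?_⟩
            rw [← mul_assoc, ← hhM', ← hhM]; rfl
          · left
            exact hor _ hv1
  obtain ⟨L, hL⟩ := exists_orthIso (SOmat g) g.1.2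
  obtain ⟨l, -, hl⟩ := L.reflections_generate_dim
  obtain ⟨M, hM, hor⟩ := hlist l
  have hMg : M = SOmat g := by
    refine clm_inj _ _ fun x => ?_
    rw [← hM, ← hL, hl]
  subst hMg
  rcases hor with ⟨h, hh, hhM⟩ | hor
  · have : h = g := Subtype.ext (Subtype.ext hhM)
    rwa [← this]
  · exfalso
    have hu : (Pi.single ⟨0, by omega⟩ 1 : Fin n → ℝ) ⬝ᵥ (Pi.single ⟨0, by omega⟩ 1) = 1 := by simp
    obtain ⟨h, hh, hhM⟩ := hor _ hu
    have h1 := congrArg det hhM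
    have h2 : (SOmat h).det = 1 := h.2
    have h3 : (SOmat g).det = 1 := g.2
    rw [det_mul, HH_det _ hu, h2, h3] at h1
    norm_num at h1

theorem charFun_orth {d : ℕ} (μ : Measure (EuclideanSpace ℝ (Fin d)))
    (A : Matrix (Fin d) (Fin d) ℝ) (hA : A ∈ Matrix.orthogonalGroup (Fin d) ℝ)
    (h : Measure.map (Matrix.toEuclideanLin A) μ = μ) (ξ) :
    charFun μ (toEuclideanCLM (𝕜 := ℝ) A ξ) = charFun μ ξ := by
  obtain ⟨L, hL⟩ := exists_orthIso A hA
  rw [← hL]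
  apply charFun_map_iso
  have : (L : EuclideanSpace ℝ (Fin d) → EuclideanSpace ℝ (Fin d)) = Matrix.toEuclideanLin A :=
    funext hL
  rw [this, h]

theorem perm_orth {d : ℕ} (π : Equiv.Perm (Fin d)) :
    π.permMatrix ℝ ∈ Matrix.orthogonalGroup (Fin d) ℝ := by
  rw [Matrix.mem_orthogonalGroup_iff, Matrix.transpose_permMatrix, ← Matrix.permMatrix_mul]
  simp

theorem exists_generator {d : ℕ} (F : EuclideanSpace ℝ (Fin d) → ℂ) (hF : ContDiff ℝ 2 F)
    (A : ℝ → Matrix (Fin d) (Fin d) ℝ) (hA : ∀ t, A t ∈ Matrix.orthogonalGroup (Fin d) ℝ)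
    (hAc : Continuous A) (hA0 : A 0 = 1) (hadd : ∀ s t, A (s + t) = A s * A t)
    (hFA : ∀ t ξ, F (toEuclideanCLM (𝕜 := ℝ) (A t) ξ) = F ξ)
    (e : EuclideanSpace ℝ (Fin d)) (s : ℝ) (he : toEuclideanCLM (𝕜 := ℝ) (A s) e ≠ e) :
    ∃ X ∈ VV F, (∀ a b, X a b = - X b a) ∧ toEuclideanCLM (𝕜 := ℝ) X e ≠ 0 := by
  set U : ℝ → (EuclideanSpace ℝ (Fin d) →L[ℝ] EuclideanSpace ℝ (Fin d)) :=
    fun t => toEuclideanCLM (𝕜 := ℝ) (A t) with hU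
  have hcont : Continuous (fun M : Matrix (Fin d) (Fin d) ℝ => toEuclideanCLM (𝕜 := ℝ) M) :=
    LinearMap.continuous_of_finiteDimensional
      ((toEuclideanCLM (n := Fin d) (𝕜 := ℝ)).toAlgEquiv.toLinearMap)
  have hUc : Continuous U := hcont.comp hAc
  have hU0 : U 0 = 1 := by simp [hU, hA0]
  have hUadd : ∀ s t, U (s + t) = U s * U t := fun s t => by simp [hU, hadd]
  obtain ⟨X, hX⟩ := oneparam U hUc hU0 hUadd
  obtain ⟨Xm, rfl⟩ : ∃ Xm, toEuclideanCLM (𝕜 := ℝ) Xm = X :=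
    EquivLike.surjective (toEuclideanCLM (n := Fin d) (𝕜 := ℝ)) X
  have hX0 : HasDerivAt U (toEuclideanCLM (𝕜 := ℝ) Xm) 0 := by
    have := hX 0
    rwa [hU0, one_mul] at this
  have hap : ∀ (L) (t : ℝ), HasDerivAt U L t → ∀ ξ, HasDerivAt (fun t => U t ξ) (L ξ) t := by
    intro L t h ξ
    simpa using h.clm_apply (hasDerivAt_const t ξ)
  refine ⟨Xm, ?_, ?_, ?_⟩
  · intro ξ
    have h1 := hap _ _ hX0 ξ
    have h2 : HasFDerivAt F (fderiv ℝ F ξ) (U 0 ξ) := by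
      rw [hU0]; exact (hF.differentiable (by norm_num) ξ).hasFDerivAt
    have h3 := h2.comp_hasDerivAt 0 h1
    have h4 : (F ∘ fun t => U t ξ) = fun _ => F ξ := funext fun t => hFA t ξ
    rw [h4] at h3
    exact h3.unique (hasDerivAt_const _ _)
  · have hstar : ∀ t, star (U t) = U (-t) := by
      intro t
      have h1 : star (A t) * A t = 1 := (Matrix.mem_unitaryGroup_iff').mp (hA t)
      have h2 : A t * A (-t) = 1 := by rw [← hadd, add_neg_cancel, hA0]
      have h3 : star (A t) = A (-t) := left_inv_eq_right_inv h1 h2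
      simp only [hU]
      rw [← h3, map_star]
    have h1 := hX0.star
    have h2 : HasDerivAt (fun t => U (-t)) (-(toEuclideanCLM (𝕜 := ℝ) Xm)) 0 := by
      have h5 : HasDerivAt U (toEuclideanCLM (𝕜 := ℝ) Xm) (-0) := by rwa [neg_zero]
      have h6 := h5.scomp (0:ℝ) (hasDerivAt_neg (0:ℝ))
      rw [neg_one_smul] at h6
      exact h6
    have h3 : (fun t => star (U t)) = fun t => U (-t) := funext hstar
    have h4 := h1.unique (h3 ▸ h2)
    rw [← map_star, ← map_neg] at h4
    have h5 := EquivLike.injective (toEuclideanCLM (n := Fin d) (𝕜 := ℝ)) h4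
    intro a b
    have h6 := congrFun (congrFun h5 b) a
    simp only [Matrix.star_apply, Matrix.neg_apply, star_trivial] at h6
    exact h6
  · intro h0
    apply he
    have hd : ∀ t, HasDerivAt (fun t => U t e) 0 t := by
      intro t
      have := hap _ _ (hX t) e
      rwa [ContinuousLinearMap.mul_apply, h0, map_zero] at this
    have := is_const_of_deriv_eq_zero (fun t => (hd t).differentiableAt) (fun t => (hd t).deriv) s 0
    simpa [hU, hA0] using this

theorem statement6 (d k : ℕ) (hd : 3 ≤ d) (hk : 3 ≤ k)
    (μ : Measure (EuclideanSpace ℝ (Fin d))) [IsProbabilityMeasure μ]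
    (hsupp : μ (Metric.sphere (0 : EuclideanSpace ℝ (Fin d)) 1)ᶜ = 0)
    (hperm : ∀ π : Equiv.Perm (Fin d),
        Measure.map (Matrix.toEuclideanLin (π.permMatrix ℝ)) μ = μ)
    (φ : SO k →* SO d) (hφcont : Continuous φ)
    (hirr : ∀ W : Submodule ℝ (EuclideanSpace ℝ (Fin d)),
        (∀ g : SO k, W.map (Matrix.toEuclideanLin (SOmat (φ g))) = W) → W = ⊥ ∨ W = ⊤)
    (hinv : ∀ g : SO k, Measure.map (Matrix.toEuclideanLin (SOmat (φ g))) μ = μ) :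
    μ = Measure.map (Subtype.val : Metric.sphere (0 : EuclideanSpace ℝ (Fin d)) 1 →
      EuclideanSpace ℝ (Fin d)) (uniformSphere d) := by
  set F := charFun μ with hFdef
  have hF : ContDiff ℝ 2 F := charFun_smooth μ hsupp
  have hP : ∀ (π : Equiv.Perm (Fin d)) ξ, F (toEuclideanCLM (𝕜 := ℝ) (π.permMatrix ℝ) ξ) = F ξ :=
    fun π ξ => charFun_orth μ _ (perm_orth π) (hperm π) ξ
  have hG : ∀ (g : SO k) ξ, F (toEuclideanCLM (𝕜 := ℝ) (SOmat (φ g)) ξ) = F ξ :=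
    fun g ξ => charFun_orth μ _ (φ g).1.2 (hinv g) ξ
  set e : EuclideanSpace ℝ (Fin d) := WithLp.toLp 2 (fun _ => 1) with he
  have he0 : e ≠ 0 := by
    intro h
    have := congrFun (congrArg WithLp.ofLp h) ⟨0, by omega⟩
    simp [he] at this
  have hmul : ∀ g h : SO k, toEuclideanCLM (𝕜 := ℝ) (SOmat (φ (g * h))) e
      = toEuclideanCLM (𝕜 := ℝ) (SOmat (φ g)) (toEuclideanCLM (𝕜 := ℝ) (SOmat (φ h)) e) := by
    intro g h
    have : SOmat (φ (g * h)) = SOmat (φ g) * SOmat (φ h) := by rw [map_mul]; rfl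
    rw [this, map_mul]; rfl
  have hone : toEuclideanCLM (𝕜 := ℝ) (SOmat (φ 1)) e = e := by
    have : SOmat (φ 1) = 1 := by rw [map_one]; rfl
    rw [this, map_one]; rfl
  let N : Subgroup (SO k) :=
    { carrier := {g | toEuclideanCLM (𝕜 := ℝ) (SOmat (φ g)) e = e}
      mul_mem' := by
        intro a b ha hb
        change _ = _ at ha hb
        change _ = _
        rw [hmul, hb, ha]
      one_mem' := hone
      inv_mem' := by
        intro a ha
        change _ = _ at ha
        change _ = _
        have h1 := hmul a⁻¹ a
        rw [ha, inv_mul_cancel, hone] at h1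
        exact h1.symm }
  have hex : ∃ v w hv hw hvw s, rotSO v w hv hw hvw s ∉ N := by
    by_contra hcon
    push Not at hcon
    have hall := SO_gen (by omega) N hcon
    have hW := hirr (ℝ ∙ e) (by
      intro g
      rw [Submodule.map_span, Set.image_singleton]
      have : Matrix.toEuclideanLin (SOmat (φ g)) e = e := hall g
      rw [this])
    rcases hW with h | h
    · exact he0 (by simpa using h)
    · have h1 := finrank_span_singleton (K := ℝ) he0
      rw [h, finrank_top, finrank_euclideanSpace_fin] at h1
      omega
  obtain ⟨v, w, hv, hw, hvw, s, hs⟩ := hex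
  obtain ⟨X, hXV, hXs, hXe⟩ := exists_generator F hF
    (fun t => SOmat (φ (rotSO v w hv hw hvw t))) (fun t => (φ _).1.2)
    (continuous_subtype_val.comp (continuous_subtype_val.comp
      (hφcont.comp (rotSO_continuous v w hv hw hvw))))
    (by simp only [rotSO_zero, map_one]; rfl)
    (fun s t => by simp only [rotSO_add, map_mul]; rfl)
    (fun t ξ => hG _ ξ) e s hs
  have hi : ∃ i, ∑ j, X i j ≠ 0 := by
    by_contra hcon
    push Not at hcon
    apply hXe
    ext i
    have := hcon i
    simpa [he, Matrix.mulVec, dotProduct] using this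
  obtain ⟨i, hi⟩ := hi
  have hE := alg_E (VV F) (VV_bracket F hF) (VV_perm F hF hP) X hXV hXs i hi
  have := uniform_prob (d := d) (by omega)
  have : IsProbabilityMeasure (Measure.map (Subtype.val :
      Metric.sphere (0 : EuclideanSpace ℝ (Fin d)) 1 → EuclideanSpace ℝ (Fin d))
      (uniformSphere d)) := Measure.isProbabilityMeasure_map measurable_subtype_coe.aemeasurable
  refine eq_of_radial μ _ hsupp ?_ (VV_radial (by omega) F hF hE) uniform_radial
  rw [Measure.map_apply measurable_subtype_coe Metric.isClosed_sphere.measurableSet.compl]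
  convert measure_empty (μ := uniformSphere d)
  ext x
  simp
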